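/- Let S be a nonempty finite set, E : S → [0,1], β* ∈ ℝ, δ ∈ (0,1), and ε > 0. If the sample size m satisfies m ≥ 2·(β*)²·ln(2/δ)/ε², then, drawing m i.i.d. samples from the Boltzmann distribution p(β*), forming the empirical distribution p̂, setting λ = √(ln(2/δ)/(2m)), and letting β̂ minimize β ↦ L_p̂(β) + λ|β|, it holds with probability at least 1 − δ that D_KL(p(β*) ‖ p(β̂)) ≤ ε. In particular, the sample complexity of approximating the Boltzmann distribution at inverse temperature β* to fixed KL accuracy is O((β*)²). -/

import Mathlib

open scoped BigOperators

/-- The Boltzmann distribution at inverse temperature `β` for energy `E`. -/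
noncomputable def boltz {S : Type*} [Fintype S] (E : S → ℝ) (β : ℝ) (σ : S) : ℝ :=
  Real.exp (-β * E σ) / ∑ σ' : S, Real.exp (-β * E σ')

/-- Cross-entropy `L_q(β)` between a distribution `q` and the Boltzmann distribution `p(β)`. -/
noncomputable def crossEnt {S : Type*} [Fintype S] (q : S → ℝ) (E : S → ℝ) (β : ℝ) : ℝ :=
  -∑ σ : S, q σ * Real.log (boltz E β σ)

/-- Kullback–Leibler divergence between distributions on a finite set. -/
noncomputable def klDiv {S : Type*} [Fintype S] (q p : S → ℝ) : ℝ :=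
  ∑ σ : S, q σ * Real.log (q σ / p σ)

/-- Empirical distribution of `m` samples. -/
noncomputable def empirical {S : Type*} [Fintype S] [DecidableEq S] {m : ℕ}
    (s : Fin m → S) (σ : S) : ℝ :=
  ((Finset.univ.filter (fun i => s i = σ)).card : ℝ) / m

/-- Probability of the event `A` under `m` i.i.d. draws from the distribution `p`. -/
noncomputable def prodProb {S : Type*} [Fintype S] (p : S → ℝ) (m : ℕ)
    (A : Set (Fin m → S)) : ℝ :=
  ∑ s : Fin m → S, A.indicator (fun s => ∏ i, p (s i)) s

open MeasureTheory ProbabilityTheory in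
lemma aux_mgf {S : Type*} [Fintype S] (p E : S → ℝ) (hp : ∀ σ, 0 ≤ p σ) (h1 : ∑ σ, p σ = 1)
    (hE : ∀ σ, 0 ≤ E σ ∧ E σ ≤ 1) (t : ℝ) :
    ∑ σ, p σ * Real.exp (t * (E σ - ∑ τ, p τ * E τ)) ≤ Real.exp (t ^ 2 / 8) := by
  letI : MeasurableSpace S := ⊤
  haveI : DiscreteMeasurableSpace S := ⟨fun _ => trivial⟩
  let μ : Measure S := ∑ σ, ENNReal.ofReal (p σ) • Measure.dirac σ
  have hint : ∀ f : S → ℝ, ∫ x, f x ∂μ = ∑ σ, p σ * f σ := by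
    intro f
    have : ∀ σ ∈ (Finset.univ : Finset S),
        Integrable f (ENNReal.ofReal (p σ) • Measure.dirac σ) := by
      intro σ _
      exact (integrable_dirac (by simp)).smul_measure (by simp)
    rw [integral_finsetSum_measure this]
    refine Finset.sum_congr rfl fun σ _ => ?_
    rw [integral_smul_measure, integral_dirac, ENNReal.toReal_ofReal (hp σ), smul_eq_mul]
  haveI : IsProbabilityMeasure μ := by
    constructor
    simp only [μ, Measure.coe_finsetSum, Finset.sum_apply, Measure.smul_apply, measure_univ,
      smul_eq_mul, mul_one]
    rw [← ENNReal.ofReal_sum_of_nonneg (fun σ _ => hp σ), h1, ENNReal.ofReal_one]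
  have h := hasSubgaussianMGF_of_mem_Icc (μ := μ) (X := E) (a := 0) (b := 1)
    (Measurable.aemeasurable (measurable_of_finite E)) (Filter.Eventually.of_forall hE)
  have h2 := h.mgf_le t
  rw [mgf, hint, hint] at h2
  refine h2.trans (le_of_eq ?_)
  congr 1
  simp
  ring

lemma aux_chernoff {S : Type*} [Fintype S] (p f : S → ℝ) (hp : ∀ σ, 0 ≤ p σ)
    (hm : ∀ t : ℝ, ∑ σ, p σ * Real.exp (t * f σ) ≤ Real.exp (t ^ 2 / 8))
    (m : ℕ) (l : ℝ) (hl : 0 ≤ l) :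
    ∑ s : Fin m → S, {s : Fin m → S | m * l < ∑ i, f (s i)}.indicator (fun s => ∏ i, p (s i)) s
      ≤ Real.exp (-2 * m * l ^ 2) := by
  have h1 : ∀ s : Fin m → S,
      {s : Fin m → S | m * l < ∑ i, f (s i)}.indicator (fun s => ∏ i, p (s i)) s
      ≤ Real.exp (-(4 * l * (m * l))) * ∏ i, (p (s i) * Real.exp (4 * l * f (s i))) := by
    intro s
    rw [Finset.prod_mul_distrib, ← Real.exp_sum, ← Finset.mul_sum]
    have h0 : 0 ≤ ∏ i, p (s i) := Finset.prod_nonneg fun i _ => hp _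
    by_cases hs : m * l < ∑ i, f (s i)
    · rw [Set.indicator_of_mem (by exact hs), mul_left_comm, ← Real.exp_add]
      refine le_mul_of_one_le_right h0 (Real.one_le_exp ?_)
      nlinarith
    · rw [Set.indicator_of_notMem (by exact hs)]
      positivity
  refine (Finset.sum_le_sum fun s _ => h1 s).trans ?_
  rw [← Finset.mul_sum, ← Fintype.sum_pow (fun σ => p σ * Real.exp (4 * l * f σ)) m]
  have h2 : (∑ σ, p σ * Real.exp (4 * l * f σ)) ^ m ≤ Real.exp ((4 * l) ^ 2 / 8) ^ m :=
    pow_le_pow_left₀ (Finset.sum_nonneg fun σ _ => mul_nonneg (hp σ) (Real.exp_pos _).le)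
      (hm _) m
  refine (mul_le_mul_of_nonneg_left h2 (Real.exp_pos _).le).trans (le_of_eq ?_)
  rw [← Real.exp_nat_mul, ← Real.exp_add]
  congr 1
  ring

lemma aux_Z {S : Type*} [Fintype S] [Nonempty S] (E : S → ℝ) (β : ℝ) :
    0 < ∑ σ : S, Real.exp (-β * E σ) :=
  Finset.sum_pos (fun _ _ => Real.exp_pos _) Finset.univ_nonempty

lemma aux_pos {S : Type*} [Fintype S] [Nonempty S] (E : S → ℝ) (β : ℝ) (σ : S) :
    0 < boltz E β σ := div_pos (Real.exp_pos _) (aux_Z E β)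

lemma aux_sum {S : Type*} [Fintype S] [Nonempty S] (E : S → ℝ) (β : ℝ) :
    ∑ σ, boltz E β σ = 1 := by
  unfold boltz
  rw [← Finset.sum_div, div_self (aux_Z E β).ne']

lemma aux_ce {S : Type*} [Fintype S] [Nonempty S] (q E : S → ℝ) (hq : ∑ σ, q σ = 1) (β : ℝ) :
    crossEnt q E β = β * ∑ σ, q σ * E σ + Real.log (∑ σ : S, Real.exp (-β * E σ)) := by
  have h : ∀ σ, q σ * Real.log (boltz E β σ) =
      -β * (q σ * E σ) - q σ * Real.log (∑ σ : S, Real.exp (-β * E σ)) := by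
    intro σ
    rw [boltz, Real.log_div (Real.exp_pos _).ne' (aux_Z E β).ne', Real.log_exp]
    ring
  unfold crossEnt
  simp only [h]
  rw [Finset.sum_sub_distrib, ← Finset.mul_sum, ← Finset.sum_mul, hq]
  ring

lemma aux_kl {S : Type*} [Fintype S] [Nonempty S] (E : S → ℝ) (b c : ℝ) :
    klDiv (boltz E b) (boltz E c) = crossEnt (boltz E b) E c - crossEnt (boltz E b) E b := by
  unfold klDiv crossEnt
  rw [sub_neg_eq_add, neg_add_eq_sub, ← Finset.sum_sub_distrib]
  refine Finset.sum_congr rfl fun σ _ => ?_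
  rw [Real.log_div (aux_pos E b σ).ne' (aux_pos E c σ).ne']
  ring

lemma aux_emp {S : Type*} [Fintype S] [DecidableEq S] {m : ℕ} (s : Fin m → S) (f : S → ℝ) :
    ∑ σ, empirical s σ * f σ = (∑ i, f (s i)) / m := by
  unfold empirical
  rw [← Finset.sum_fiberwise (s := Finset.univ) (g := s) (f := fun i => f (s i)), Finset.sum_div]
  refine Finset.sum_congr rfl fun σ _ => ?_
  rw [Finset.sum_congr rfl (g := fun _ => f σ)
    (fun i hi => by rw [(Finset.mem_filter.1 hi).2])]
  rw [Finset.sum_const, nsmul_eq_mul]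
  ring

theorem boltzmann_sample_complexity
    {S : Type*} [Fintype S] [Nonempty S] [DecidableEq S]
    (E : S → ℝ) (hE : ∀ σ, 0 ≤ E σ ∧ E σ ≤ 1)
    (βstar δ ε : ℝ) (hδ : 0 < δ ∧ δ < 1) (hε : 0 < ε)
    (m : ℕ) (hm : 1 ≤ m)
    (hsample : 2 * βstar ^ 2 * Real.log (2 / δ) / ε ^ 2 ≤ (m : ℝ))
    (lam : ℝ) (hlam : lam = Real.sqrt (Real.log (2 / δ) / (2 * m)))
    (βhat : (Fin m → S) → ℝ)
    (hβhat : ∀ s : Fin m → S, ∀ β : ℝ,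
      crossEnt (empirical s) E (βhat s) + lam * |βhat s| ≤
        crossEnt (empirical s) E β + lam * |β|) :
    1 - δ ≤ prodProb (boltz E βstar) m
      {s | klDiv (boltz E βstar) (boltz E (βhat s)) ≤ ε} := by
  have hm0 : (0 : ℝ) < m := by exact_mod_cast hm
  obtain ⟨hδ0, hδ1⟩ := hδ
  set p := boltz E βstar with hpdef
  have hp : ∀ σ, 0 ≤ p σ := fun σ => (aux_pos E βstar σ).le
  have hp1 : ∑ σ, p σ = 1 := aux_sum E βstar
  set M := ∑ τ, p τ * E τ with hM
  have hlog : 0 < Real.log (2 / δ) := Real.log_pos (by rw [lt_div_iff₀ hδ0]; linarith)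
  have hl0 : 0 ≤ lam := hlam ▸ Real.sqrt_nonneg _
  have hl2 : lam ^ 2 = Real.log (2 / δ) / (2 * m) := by
    rw [hlam, Real.sq_sqrt (by positivity)]
  have hmgf := aux_mgf p E hp hp1 hE
  have hexp : Real.exp (-2 * m * lam ^ 2) = δ / 2 := by
    have : -2 * m * lam ^ 2 = -Real.log (2 / δ) := by rw [hl2]; field_simp
    rw [this, Real.exp_neg, Real.exp_log (by positivity), inv_div]
  have hA := aux_chernoff p (fun σ => E σ - M) hp hmgf m lam hl0
  have hB := aux_chernoff p (fun σ => -(E σ - M)) hp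
    (fun t => by simpa only [neg_mul, mul_neg, neg_sq, even_two.neg_pow] using hmgf (-t)) m lam hl0
  rw [hexp] at hA hB
  have htot : ∑ s : Fin m → S, ∏ i, p (s i) = 1 := by
    rw [← Fintype.sum_pow p m, hp1, one_pow]
  have heps : 2 * (lam * |βstar|) ≤ ε := by
    refine abs_le_of_sq_le_sq' ?_ hε.le |>.2
    have : (2 * (lam * |βstar|)) ^ 2 = 2 * βstar ^ 2 * Real.log (2 / δ) / m := by
      rw [mul_pow, mul_pow, hl2, sq_abs]; field_simp; try ring
    rw [this, div_le_iff₀ hm0]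
    rw [div_le_iff₀ (by positivity)] at hsample
    linarith
  have key : ∀ s : Fin m → S, ¬ (m * lam < ∑ i, (E (s i) - M)) →
      ¬ (m * lam < ∑ i, -(E (s i) - M)) → klDiv p (boltz E (βhat s)) ≤ ε := by
    intro s h1 h2
    have hsum : ∑ i, (E (s i) - M) = ∑ i, E (s i) - m * M := by
      simp [Finset.sum_sub_distrib]
    rw [Finset.sum_neg_distrib] at h2
    rw [hsum] at h1 h2
    have he1 : ∑ σ, empirical s σ = 1 := by
      have := aux_emp s (fun _ => 1)
      simpa [hm0.ne'] using this
    have he := aux_emp s E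
    have hb := hβhat s βstar
    rw [aux_ce _ _ he1, aux_ce _ _ he1] at hb
    rw [hpdef, aux_kl, ← hpdef, aux_ce _ _ hp1, aux_ce _ _ hp1, ← hM]
    set N := ∑ σ, empirical s σ * E σ with hN
    have hN' : ∑ i, E (s i) = m * N := by rw [he]; field_simp
    rw [hN'] at h1 h2
    have hd : |M - N| ≤ lam := by
      rw [abs_le]
      constructor
      · by_contra hc
        exact h1 (by nlinarith)
      · by_contra hc
        exact h2 (by nlinarith)
    have h3 : (βhat s - βstar) * (M - N) ≤ (|βhat s| + |βstar|) * lam := by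
      refine (le_abs_self _).trans ?_
      rw [abs_mul]
      exact mul_le_mul (abs_sub _ _) hd (abs_nonneg _) (by positivity)
    nlinarith
  have hpt : ∀ s : Fin m → S, ∏ i, p (s i) ≤
      {s | klDiv p (boltz E (βhat s)) ≤ ε}.indicator (fun s => ∏ i, p (s i)) s
      + {s : Fin m → S | m * lam < ∑ i, (E (s i) - M)}.indicator (fun s => ∏ i, p (s i)) s
      + {s : Fin m → S | m * lam < ∑ i, -(E (s i) - M)}.indicator (fun s => ∏ i, p (s i)) s := by
    intro s
    have h0 : 0 ≤ ∏ i, p (s i) := Finset.prod_nonneg fun i _ => hp _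
    have := key s
    simp only [Set.indicator_apply, Set.mem_setOf_eq]
    split_ifs <;> first | linarith | (exfalso; tauto)
  have hfin := Finset.sum_le_sum fun s (_ : s ∈ Finset.univ) => hpt s
  rw [htot, Finset.sum_add_distrib, Finset.sum_add_distrib] at hfin
  unfold prodProb
  linarith
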